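/- arXiv:1205.3826 — 2 statements merged into one kernel-verified Lean document; each statement's English description precedes it below -/
import Mathlib

section
/- Let N ≥ 2 and let Γ : ℝ → ℝ be 2π-periodic, twice differentiable on (0, 2π), with Γ′ of constant nonzero sign on (0, 2π) (either Γ′(θ) < 0 for every θ ∈ (0, 2π) or Γ′(θ) > 0 for every θ ∈ (0, 2π)) and with second derivative of constant sign on (0, 2π). If θ̃ ∈ C satisfies, for every k ∈ {1,…,N−1}, Γ(θ̃_k) + Σ_{j=1, j≠k}^{N−1} Γ(θ̃_k − θ̃_j) − Σ_{j=1}^{N−1} Γ(−θ̃_j) = 0, then θ̃_k = 2πk/N for every k ∈ {1,…,N−1}; that is, the splay state is the unique fixed point of the phase-difference dynamics in the open cone C. -/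
open Real Filter Set Topology

noncomputable section

/-- Right-hand side of the phase-difference dynamics on `ℝ^{N-1}` (components `1,…,N-1`). -/
def fullRHS (N : ℕ) (Γ : ℝ → ℝ) (x : ℕ → ℝ) (k : ℕ) : ℝ :=
  Γ (x k) + ∑ j ∈ (Finset.Icc 1 (N - 1)).erase k, Γ (x k - x j)
    - ∑ j ∈ Finset.Icc 1 (N - 1), Γ (-(x j))

/-- The open cone `C = {0 < x₁ < x₂ < … < x_{N-1} < 2π}`. -/
def inCone (N : ℕ) (x : ℕ → ℝ) : Prop :=
  0 < x 1 ∧ (∀ k ∈ Finset.Icc 1 (N - 2), x k < x (k + 1)) ∧ x (N - 1) < 2 * π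

/-- The sum of an `N`-periodic sequence over `N` consecutive indices does not depend on the
starting index. -/
theorem sum_range_add_of_periodic {N : ℕ} {f : ℕ → ℝ} (hf : ∀ j, f (j + N) = f j) (a : ℕ) :
    ∑ j ∈ Finset.range N, f (a + j) = ∑ j ∈ Finset.range N, f j := by
  induction a with
  | zero => simp
  | succ a ih =>
    rw [← ih]
    have h1 := Finset.sum_range_succ (fun j => f (a + j)) N
    have h2 := Finset.sum_range_succ' (fun j => f (a + j)) N
    have h3 : ∑ j ∈ Finset.range N, f (a + 1 + j) = ∑ j ∈ Finset.range N, f (a + (j + 1)) :=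
      Finset.sum_congr rfl fun j _ => by rw [add_assoc, add_comm 1 j]
    rw [h3]
    simp only [hf, add_zero] at h1 h2
    linarith

/-- If all oscillators of a strictly ordered configuration on the circle, lifted to the line, have
the same velocity under a strictly monotone coupling, then they are equally spaced. -/
theorem equally_spaced_of_sum_eq {N : ℕ} (hN : 0 < N) {Γ : ℝ → ℝ}
    (hper : ∀ θ : ℝ, Γ (θ + 2 * π) = Γ θ) (hmono : StrictMonoOn Γ (Ioo 0 (2 * π)))
    {y : ℕ → ℝ} (hy : StrictMono y) (hyN : ∀ j, y (j + N) = y j + 2 * π)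
    (hS : ∀ k ≤ N, ∑ j ∈ Finset.range N, Γ (y k - y j) = ∑ j ∈ Finset.range N, Γ (y 0 - y j))
    (k : ℕ) : y k = y 0 + 2 * π * k / N := by
  have hS' (k : ℕ) :
      ∑ j ∈ Finset.range N, Γ (y k - y (k + j)) = ∑ j ∈ Finset.range N, Γ (y k - y j) :=
    sum_range_add_of_periodic (f := fun j => Γ (y k - y j))
      (fun j => by rw [← hper, hyN]; congr 1; ring) k
  have hd (j : ℕ) : y (j + N + 1) - y (j + N) = y (j + 1) - y j := by
    rw [add_right_comm, hyN, hyN]; ring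
  obtain ⟨m, hm, hmax⟩ := Finset.exists_max_image (Finset.range N) (fun k => y (k + 1) - y k)
    ⟨0, by simpa using hN⟩
  rw [Finset.mem_range] at hm
  have hmax' (i : ℕ) : y (i + 1) - y i ≤ y (m + 1) - y m := by
    have hp : Function.Periodic (fun k => y (k + 1) - y k) N := hd
    have := hmax (i % N) (Finset.mem_range.2 (Nat.mod_lt _ hN))
    rwa [hp.map_mod_nat i] at this
  have harg {k j : ℕ} (h0 : 0 < j) (hj : j < N) :
      y k - y (k + j) + 2 * π ∈ Ioo 0 (2 * π) := by
    have h1 := hy (show k < k + j by omega)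
    have h2 := hy (show k + j < k + N by omega)
    rw [hyN] at h2
    constructor <;> linarith
  have hle : ∀ j ∈ Finset.range N,
      Γ (y m - y (m + j)) ≤ Γ (y (m + 1) - y (m + 1 + j)) := by
    intro j hj
    rw [Finset.mem_range] at hj
    rcases Nat.eq_zero_or_pos j with rfl | h0
    · simp
    · rw [← hper, ← hper (y (m + 1) - _)]
      refine hmono.monotoneOn (harg h0 hj) (harg h0 hj) ?_
      have := hmax' (m + j)
      rw [add_right_comm m 1 j]
      linarith
  have heq := (Finset.sum_eq_sum_iff_of_le hle).1
    (by rw [hS', hS', hS m hm.le, hS (m + 1) hm])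
  have hgap (j : ℕ) (hj : j < N) : y (m + j + 1) - y (m + j) = y (m + 1) - y m := by
    rcases Nat.eq_zero_or_pos j with rfl | h0
    · simp
    · have h := heq j (Finset.mem_range.2 hj)
      rw [← hper, ← hper (y (m + 1) - _)] at h
      have := hmono.injOn (harg h0 hj) (harg h0 hj) h
      rw [add_right_comm m 1 j] at this
      linarith
  have hgap' (i : ℕ) : y (i + 1) - y i = y (m + 1) - y m := by
    have hp : Function.Periodic (fun k => y (k + 1) - y k) N := hd
    have hi := Nat.mod_lt i hN
    have h := hp.map_mod_nat i
    rw [← h]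
    rcases le_or_gt m (i % N) with hmi | hmi
    · simpa [Nat.add_sub_cancel' hmi] using hgap (i % N - m) (by omega)
    · rw [← hd, ← hgap (i % N + N - m) (by omega), Nat.add_sub_cancel' (by omega)]
  have hlin (i : ℕ) : y i = y 0 + i * (y (m + 1) - y m) := by
    induction i with
    | zero => simp
    | succ i ih => push_cast; linarith [hgap' i]
  have hN0 : (N : ℝ) ≠ 0 := by exact_mod_cast hN.ne'
  have h := hlin N
  have h0 := hyN 0
  rw [zero_add] at h0
  rw [hlin k, show 2 * π = N * (y (m + 1) - y m) by linarith]
  field_simp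

/-- The lift to the line of the phases `0, x₁, …, x_{N-1}`, increasing by `2π` every `N` steps. -/
def liftedPhase (N : ℕ) (x : ℕ → ℝ) (k : ℕ) : ℝ :=
  (if k % N = 0 then 0 else x (k % N)) + 2 * π * (k / N : ℕ)

theorem liftedPhase_add {N : ℕ} (hN : 0 < N) (x : ℕ → ℝ) (k : ℕ) :
    liftedPhase N x (k + N) = liftedPhase N x k + 2 * π := by
  simp only [liftedPhase, Nat.add_mod_right, Nat.add_div_right k hN]
  push_cast
  ring

theorem liftedPhase_zero (N : ℕ) (x : ℕ → ℝ) : liftedPhase N x 0 = 0 := by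
  simp [liftedPhase]

theorem liftedPhase_of_mem {N : ℕ} (x : ℕ → ℝ) {k : ℕ} (hk : k ∈ Finset.Icc 1 (N - 1)) :
    liftedPhase N x k = x k := by
  rw [Finset.mem_Icc] at hk
  have h : k < N := by omega
  simp [liftedPhase, Nat.mod_eq_of_lt h, Nat.div_eq_of_lt h, show k ≠ 0 by omega]

theorem liftedPhase_strictMono {N : ℕ} (hN : 2 ≤ N) {x : ℕ → ℝ} (hx : inCone N x) :
    StrictMono (liftedPhase N x) := by
  obtain ⟨h0, hstep, hlast⟩ := hx
  refine strictMono_nat_of_lt_succ fun k => ?_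
  induction k using Nat.strong_induction_on with
  | _ k ih =>
    rcases lt_or_ge k N with hk | hk
    · rcases Nat.eq_zero_or_pos k with rfl | hpos
      · rw [liftedPhase_zero, liftedPhase_of_mem x (by simp; omega)]
        exact h0
      · rw [liftedPhase_of_mem x (k := k) (by simp; omega)]
        rcases Nat.lt_or_ge (k + 1) N with hk1 | hk1
        · rw [liftedPhase_of_mem x (by simp; omega)]
          exact hstep k (by simp; omega)
        · have h := liftedPhase_add (by omega : 0 < N) x 0
          rw [liftedPhase_zero, zero_add, zero_add] at h
          rw [show k + 1 = N by omega, h, show k = N - 1 by omega]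
          exact hlast
    · obtain ⟨i, rfl⟩ := Nat.exists_eq_add_of_le' hk
      have h := ih i (by omega)
      rw [add_right_comm, liftedPhase_add (by omega), liftedPhase_add (by omega)]
      linarith

theorem fullRHS_eq_sum_sub_sum {N : ℕ} (hN : 0 < N) (Γ : ℝ → ℝ) (x : ℕ → ℝ) {k : ℕ}
    (hk : k ∈ Finset.Icc 1 (N - 1)) :
    fullRHS N Γ x k = ∑ j ∈ Finset.range N, Γ (liftedPhase N x k - liftedPhase N x j)
      - ∑ j ∈ Finset.range N, Γ (liftedPhase N x 0 - liftedPhase N x j) := by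
  have hr : Finset.range N = insert 0 (Finset.Icc 1 (N - 1)) := by
    ext j
    simp only [Finset.mem_range, Finset.mem_insert, Finset.mem_Icc]
    omega
  have hsum (t : ℝ) : ∑ j ∈ Finset.range N, Γ (t - liftedPhase N x j)
      = Γ t + ∑ j ∈ Finset.Icc 1 (N - 1), Γ (t - x j) := by
    rw [hr, Finset.sum_insert (by simp), liftedPhase_zero, sub_zero]
    congr 1
    exact Finset.sum_congr rfl fun j hj => by rw [liftedPhase_of_mem x hj]
  rw [hsum, hsum, liftedPhase_zero, liftedPhase_of_mem x hk,
    ← Finset.add_sum_erase _ (fun j => Γ (x k - x j)) hk]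
  simp only [fullRHS, sub_self, zero_sub]
  ring

theorem fullRHS_neg (N : ℕ) (Γ : ℝ → ℝ) (x : ℕ → ℝ) (k : ℕ) :
    fullRHS N (fun θ => -Γ θ) x k = -fullRHS N Γ x k := by
  simp only [fullRHS, Finset.sum_neg_distrib]
  ring

/-- Uniqueness of the splay state for a strictly increasing coupling function. -/
theorem eq_splay_of_strictMonoOn {N : ℕ} (hN : 2 ≤ N) {Γ : ℝ → ℝ}
    (hper : ∀ θ : ℝ, Γ (θ + 2 * π) = Γ θ) (hmono : StrictMonoOn Γ (Ioo 0 (2 * π)))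
    {x : ℕ → ℝ} (hx : inCone N x)
    (hfix : ∀ k ∈ Finset.Icc 1 (N - 1), fullRHS N Γ x k = 0) :
    ∀ k ∈ Finset.Icc 1 (N - 1), x k = 2 * π * k / N := by
  have hN0 : 0 < N := by omega
  intro k hk
  rw [← liftedPhase_of_mem x hk]
  have h := equally_spaced_of_sum_eq hN0 hper hmono (liftedPhase_strictMono hN hx)
    (liftedPhase_add hN0 x) ?_ k
  · rwa [liftedPhase_zero, zero_add] at h
  · intro i hi
    rcases Nat.eq_zero_or_pos i with rfl | hpos
    · rfl
    rcases hi.eq_or_lt with rfl | hlt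
    · refine Finset.sum_congr rfl fun j _ => ?_
      have h := liftedPhase_add hN0 x 0
      rw [zero_add] at h
      rw [h, ← hper (liftedPhase i x 0 - _)]
      congr 1
      ring
    · have hi' : i ∈ Finset.Icc 1 (N - 1) := by simp; omega
      have h := fullRHS_eq_sum_sub_sum hN0 Γ x hi'
      rw [hfix i hi'] at h
      linarith

/-- For a monotone coupling function the splay state is the unique fixed point of the
phase-difference dynamics in the open cone `C`. -/
theorem splay_state_unique_fixed_point_in_cone
    (N : ℕ) (hN : 2 ≤ N) (Γ Γ' Γ'' : ℝ → ℝ)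
    (hper : ∀ θ : ℝ, Γ (θ + 2 * π) = Γ θ)
    (hd1 : ∀ θ ∈ Ioo (0 : ℝ) (2 * π), HasDerivAt Γ (Γ' θ) θ)
    (hd2 : ∀ θ ∈ Ioo (0 : ℝ) (2 * π), HasDerivAt Γ' (Γ'' θ) θ)
    (hmono : (∀ θ ∈ Ioo (0 : ℝ) (2 * π), Γ' θ < 0) ∨
      (∀ θ ∈ Ioo (0 : ℝ) (2 * π), 0 < Γ' θ))
    (hcurv : (∀ θ ∈ Ioo (0 : ℝ) (2 * π), 0 ≤ Γ'' θ) ∨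
      (∀ θ ∈ Ioo (0 : ℝ) (2 * π), Γ'' θ ≤ 0))
    (x : ℕ → ℝ) (hx : inCone N x)
    (hfix : ∀ k ∈ Finset.Icc 1 (N - 1), fullRHS N Γ x k = 0) :
    ∀ k ∈ Finset.Icc 1 (N - 1), x k = 2 * π * k / N := by
  rcases hmono with h | h
  · refine eq_splay_of_strictMonoOn hN (Γ := fun θ => -Γ θ) (fun θ => by rw [hper]) ?_ hx
      fun k hk => by rw [fullRHS_neg, hfix k hk, neg_zero]
    refine strictMonoOn_of_hasDerivWithinAt_pos (f' := fun θ => -Γ' θ) (convex_Ioo _ _)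
      (fun θ hθ => (hd1 θ hθ).neg.continuousAt.continuousWithinAt) ?_ ?_ <;>
      rw [interior_Ioo]
    · exact fun θ hθ => (hd1 θ hθ).neg.hasDerivWithinAt
    · exact fun θ hθ => neg_pos.2 (h θ hθ)
  · refine eq_splay_of_strictMonoOn hN hper ?_ hx hfix
    refine strictMonoOn_of_hasDerivWithinAt_pos (f' := Γ') (convex_Ioo _ _)
      (fun θ hθ => (hd1 θ hθ).continuousAt.continuousWithinAt) ?_ ?_ <;>
      rw [interior_Ioo]
    · exact fun θ hθ => (hd1 θ hθ).hasDerivWithinAt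
    · exact h
end
end

section
/- Let N ≥ 2 and let Γ : ℝ → ℝ be 2π-periodic, twice differentiable on (0, 2π), with Γ′(θ) > 0 for every θ ∈ (0, 2π), with second derivative of constant sign on (0, 2π), and with finite one-sided limits L₀ = lim_{θ→0⁺} Γ(θ) and L_{2π} = lim_{θ→2π⁻} Γ(θ). If Θ : [0, ∞) → ℝ^{N−1} is a solution of the phase-difference dynamics with Θ(t) ∈ C for every t ≥ 0, then Θ(t) equals the splay state θ̃* (θ̃*_k = 2πk/N) for every t ≥ 0; that is, the splay state is the only orbit that remains in the open cone C for all forward time. -/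
open Real Filter Set Topology

noncomputable section

/-- `Θ` is a solution of the phase-difference dynamics on `I`. -/
def IsSolFull (N : ℕ) (Γ : ℝ → ℝ) (I : Set ℝ) (Θ : ℝ → ℕ → ℝ) : Prop :=
  ∀ k ∈ Finset.Icc 1 (N - 1), ∀ t ∈ I,
    HasDerivAt (fun s => Θ s k) (fullRHS N Γ (Θ t) k) t

/-- If every maximal member of a finite family of differentiable functions that lies above the
level `A` grows at rate at least `c`, then the maximum of the family grows at least linearly. -/
theorem exists_add_mul_le_of_deriv_max_ge {ι : Type*} (s : Finset ι) (f f' : ι → ℝ → ℝ)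
    {a A c : ℝ} (hc : 0 < c)
    (hf : ∀ i ∈ s, ∀ t, a ≤ t → HasDerivAt (f i) (f' i t) t)
    (hmax : ∀ i ∈ s, ∀ t, a ≤ t → (∀ j ∈ s, f j t ≤ f i t) → A ≤ f i t → c ≤ f' i t)
    (hA : ∃ i ∈ s, A ≤ f i a) {t : ℝ} (ht : a ≤ t) :
    ∃ i ∈ s, A + c / 2 * (t - a) ≤ f i t := by
  classical
  have hs : s.Nonempty := hA.imp fun _ h => h.1
  choose! m hms hm using fun t : ℝ => s.exists_max_image (fun i => f i t) hs
  have hD : ∀ x, s.sup' hs (fun i => f i x) = f (m x) x := fun x =>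
    le_antisymm (Finset.sup'_le _ _ fun i hi => hm x i hi)
      (Finset.le_sup' (fun i => f i x) (hms x))
  have key : ∀ ⦃x⦄, x ∈ Icc a t →
      -s.sup' hs (fun i => f i x) ≤ -(A + c / 2 * (x - a)) := by
    refine image_le_of_liminf_slope_right_lt_deriv_boundary'
      (f' := fun x => -f' (m x) x) (B' := fun _ => -(c / 2)) ?_ ?_ ?_ ?_ ?_ ?_
    · refine ContinuousOn.neg (ContinuousOn.finset_sup'_apply hs fun i hi x hx => ?_)
      exact (hf i hi x hx.1).continuousAt.continuousWithinAt
    · intro x hx r hr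
      have hd := (hf (m x) (hms x) x hx.1).neg
      have h1 : ∀ᶠ z in 𝓝[>] x, slope (-f (m x)) x z < r :=
        (hasDerivWithinAt_iff_tendsto_slope' self_notMem_Ioi).1
          hd.hasDerivWithinAt |>.eventually_lt_const hr
      refine Eventually.frequently ?_
      filter_upwards [h1, self_mem_nhdsWithin] with z hz hxz
      refine lt_of_le_of_lt ?_ hz
      have hxz' : 0 < z - x := sub_pos.2 hxz
      simp only [slope_def_field, Pi.neg_apply]
      rw [hD x]
      gcongr
      exact Finset.le_sup' (fun i => f i z) (hms x)
    · obtain ⟨i, hi, h⟩ := hA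
      have := h.trans (Finset.le_sup' (fun i => f i a) hi)
      rw [sub_self, mul_zero, add_zero]
      exact neg_le_neg this
    · fun_prop
    · intro x _
      have := ((((hasDerivAt_id x).sub_const a).const_mul (c / 2)).const_add A).neg
      rw [mul_one] at this
      exact this.hasDerivWithinAt
    · intro x hx h
      rw [hD x, neg_inj] at h
      have h0 : 0 ≤ c / 2 * (x - a) := mul_nonneg (by linarith) (by linarith [hx.1])
      have := hmax (m x) (hms x) x hx.1 (hm x) (by linarith)
      linarith
  refine ⟨m t, hms t, ?_⟩
  have := key (right_mem_Icc.2 ht)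
  rw [hD t] at this
  linarith

/-- The phases including the reference phase `0` at index `0`. -/
def withReference (x : ℕ → ℝ) (k : ℕ) : ℝ := if k = 0 then 0 else x k

/-- Total coupling felt by the phase `x k` among the phases `x 0, …, x (N - 1)`. -/
def coupling (N : ℕ) (Γ : ℝ → ℝ) (x : ℕ → ℝ) (k : ℕ) : ℝ :=
  ∑ j ∈ (Finset.range N).erase k, Γ (x k - x j)

/-- The equally spaced phases. -/
def splay (N k : ℕ) : ℝ := 2 * π * k / N

theorem range_erase_zero (N : ℕ) : (Finset.range N).erase 0 = Finset.Icc 1 (N - 1) := by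
  ext j
  simp only [Finset.mem_erase, Finset.mem_range, Finset.mem_Icc]
  omega

theorem coupling_withReference_zero (N : ℕ) (Γ : ℝ → ℝ) (x : ℕ → ℝ) :
    coupling N Γ (withReference x) 0 = ∑ j ∈ Finset.Icc 1 (N - 1), Γ (-(x j)) := by
  rw [coupling, range_erase_zero]
  refine Finset.sum_congr rfl fun j hj => ?_
  have : j ≠ 0 := by have := (Finset.mem_Icc.1 hj).1; omega
  simp [withReference, this]

theorem fullRHS_eq_coupling_sub {N : ℕ} (Γ : ℝ → ℝ) (x : ℕ → ℝ) {k : ℕ}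
    (hk : k ∈ Finset.Icc 1 (N - 1)) :
    fullRHS N Γ x k =
      coupling N Γ (withReference x) k - coupling N Γ (withReference x) 0 := by
  rw [coupling_withReference_zero, fullRHS, coupling]
  have hk' := Finset.mem_Icc.1 hk
  have h0 : 0 ∈ (Finset.range N).erase k := by
    simp only [Finset.mem_erase, Finset.mem_range]; omega
  have hk0 : k ≠ 0 := by omega
  rw [← Finset.add_sum_erase _ _ h0, Finset.erase_right_comm, range_erase_zero]
  congr 2
  · simp [withReference, hk0]
  · refine Finset.sum_congr rfl fun j hj => ?_
    have : j ≠ 0 := by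
      have := (Finset.mem_Icc.1 (Finset.mem_of_mem_erase hj)).1; omega
    simp [withReference, hk0, this]

/-- Configurations of `N` strictly ordered phases inside an arc of length less than `2π`. -/
def IsOrdered (N : ℕ) (x : ℕ → ℝ) : Prop :=
  ∀ i j, i < j → j < N → x j - x i ∈ Ioo 0 (2 * π)

theorem inCone.isOrdered {N : ℕ} {x : ℕ → ℝ} (h : inCone N x) :
    IsOrdered N (withReference x) := by
  obtain ⟨h0, hs, h1⟩ := h
  have step : ∀ i, i + 1 < N → withReference x i < withReference x (i + 1) := by
    rintro (_ | i) hi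
    · simpa [withReference] using h0
    · simpa [withReference] using hs (i + 1) (Finset.mem_Icc.2 ⟨by omega, by omega⟩)
  have mono : ∀ i j, i ≤ j → j < N → withReference x i ≤ withReference x j := by
    intro i j hij
    induction j, hij using Nat.le_induction with
    | base => exact fun _ => le_rfl
    | succ j hij ih => exact fun hj => (ih (by omega)).trans (step j hj).le
  intro i j hij hj
  have hi0 : 0 ≤ withReference x i := by
    simpa [withReference] using mono 0 i (by omega) (by omega)
  have hj1 : withReference x j < 2 * π := by
    refine (mono j (N - 1) (by omega) (by omega)).trans_lt ?_
    simpa [withReference, show N - 1 ≠ 0 by omega] using h1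
  have := (step i (by omega)).trans_le (mono (i + 1) j hij hj)
  constructor <;> linarith

theorem isOrdered_splay (N : ℕ) : IsOrdered N (splay N) := by
  intro i j hij hj
  have hN : (0 : ℝ) < N := by exact_mod_cast (by omega : 0 < N)
  have hij' : (i : ℝ) < j := by exact_mod_cast hij
  have hj' : (j : ℝ) < N := by exact_mod_cast hj
  have hi0 : (0 : ℝ) ≤ i := i.cast_nonneg
  have e : splay N j - splay N i = 2 * π * ((j - i) / N) := by
    unfold splay; ring
  rw [e]
  constructor
  · have : 0 < (j - i : ℝ) / N := div_pos (by linarith) hN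
    positivity
  · have : (j - i : ℝ) / N < 1 := (div_lt_one hN).2 (by linarith)
    nlinarith [pi_pos]

/-- At the splay state all phases feel the same coupling. -/
theorem coupling_splay {N : ℕ} {Γ : ℝ → ℝ} (hper : ∀ θ, Γ (θ + 2 * π) = Γ θ) {k : ℕ}
    (hk : k < N) : coupling N Γ (splay N) k = coupling N Γ (splay N) 0 := by
  have e : ∀ k < N, coupling N Γ (splay N) k =
      ∑ j ∈ Finset.range N, Γ (splay N k - splay N j) - Γ 0 := by
    intro k hk
    rw [coupling, Finset.sum_erase_eq_sub (Finset.mem_range.2 hk), sub_self]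
  induction k with
  | zero => rfl
  | succ k ih =>
    rw [← ih (by omega), e _ hk, e k (by omega)]
    congr 1
    obtain ⟨M, rfl⟩ : ∃ M, N = M + 1 := ⟨N - 1, by omega⟩
    rw [Finset.sum_range_succ', Finset.sum_range_succ]
    have hM : ((M : ℝ) + 1) ≠ 0 := by positivity
    congr 1
    · refine Finset.sum_congr rfl fun j _ => congrArg Γ ?_
      simp only [splay]; push_cast; ring
    · rw [← hper (splay (M + 1) k - splay (M + 1) M)]
      congr 1
      simp only [splay]; push_cast; field_simp; ring

theorem IsOrdered.coupling_term_mono {N : ℕ} {Γ : ℝ → ℝ} {x y : ℕ → ℝ}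
    (hx : IsOrdered N x) (hy : IsOrdered N y)
    (hper : ∀ θ, Γ (θ + 2 * π) = Γ θ) (hΓ : StrictMonoOn Γ (Ioo 0 (2 * π)))
    {k j : ℕ} (hk : k < N) (hj : j < N) (hkj : j ≠ k) (h : y k - y j ≤ x k - x j) :
    Γ (y k - y j) ≤ Γ (x k - x j) := by
  rcases lt_or_gt_of_ne hkj with hlt | hlt
  · exact hΓ.monotoneOn (hy _ _ hlt hk) (hx _ _ hlt hk) h
  · rw [← hper (y k - y j), ← hper (x k - x j)]
    have h1 := hy _ _ hlt hj
    have h2 := hx _ _ hlt hj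
    refine hΓ.monotoneOn ?_ ?_ (by linarith) <;> constructor <;>
      linarith [h1.1, h1.2, h2.1, h2.2]

/-- On an interval, increments of a strictly increasing function over steps of length at least `A`
from a fixed base point are bounded away from zero. -/
theorem eventually_forall_le_sub {Γ : ℝ → ℝ} {S : Set ℝ} [S.OrdConnected]
    (hΓ : StrictMonoOn Γ S) {v A : ℝ} (hv : v ∈ S) (hA : 0 < A) :
    ∀ᶠ c in 𝓝[>] (0 : ℝ), ∀ u ∈ S, v + A ≤ u → c ≤ Γ u - Γ v := by
  by_cases hS : v + A ∈ S
  · have h : 0 < Γ (v + A) - Γ v := sub_pos.2 (hΓ hv hS (by linarith))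
    filter_upwards [Ioc_mem_nhdsGT h] with c hc u hu hle
    linarith [hc.2, hΓ.monotoneOn hS hu hle]
  · refine Eventually.of_forall fun c u hu hle => (hS ?_).elim
    exact Set.OrdConnected.out' hv hu ⟨by linarith, hle⟩

theorem IsOrdered.exists_pos_le_coupling_term_sub {N : ℕ} {Γ : ℝ → ℝ} {y : ℕ → ℝ}
    (hy : IsOrdered N y) (hper : ∀ θ, Γ (θ + 2 * π) = Γ θ)
    (hΓ : StrictMonoOn Γ (Ioo 0 (2 * π))) {A : ℝ} (hA : 0 < A) :
    ∃ c > 0, ∀ k < N, ∀ l < N, l ≠ k → ∀ x, IsOrdered N x →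
      y k - y l + A ≤ x k - x l → c ≤ Γ (x k - x l) - Γ (y k - y l) := by
  have h : ∀ᶠ c in 𝓝[>] (0 : ℝ), ∀ k ∈ Finset.range N, ∀ l ∈ Finset.range N, l ≠ k →
      ∀ x, IsOrdered N x →
      y k - y l + A ≤ x k - x l → c ≤ Γ (x k - x l) - Γ (y k - y l) := by
    refine (Filter.eventually_all_finset _).2 fun k hk =>
      (Filter.eventually_all_finset _).2 fun l hl => ?_
    rw [Finset.mem_range] at hk hl
    rcases lt_trichotomy l k with hlt | rfl | hlt
    · filter_upwards [eventually_forall_le_sub hΓ (hy _ _ hlt hk) hA] with c hc _ x hx hle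
      exact hc _ (hx _ _ hlt hk) hle
    · exact Eventually.of_forall fun c h => (h rfl).elim
    · have shift : ∀ x, IsOrdered N x → x k - x l + 2 * π ∈ Ioo 0 (2 * π) := by
        intro x hx
        have := hx _ _ hlt hl
        constructor <;> linarith [this.1, this.2]
      filter_upwards [eventually_forall_le_sub hΓ (shift y hy) hA] with c hc _ x hx hle
      have := hc _ (shift x hx) (by linarith)
      rwa [hper, hper] at this
  obtain ⟨c, hc, hc0⟩ := (h.and self_mem_nhdsWithin).exists
  exact ⟨c, hc0, fun k hk l hl => hc k (Finset.mem_range.2 hk) l (Finset.mem_range.2 hl)⟩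

/-- For an increasing monotone coupling function, the splay state is the only orbit of the
phase-difference dynamics remaining in the open cone `C` for all forward time. -/
theorem splay_only_forward_invariant_orbit
    (N : ℕ) (hN : 2 ≤ N) (Γ Γ' Γ'' : ℝ → ℝ) (L₀ L₂π : ℝ)
    (hper : ∀ θ : ℝ, Γ (θ + 2 * π) = Γ θ)
    (hd1 : ∀ θ ∈ Ioo (0 : ℝ) (2 * π), HasDerivAt Γ (Γ' θ) θ)
    (hd2 : ∀ θ ∈ Ioo (0 : ℝ) (2 * π), HasDerivAt Γ' (Γ'' θ) θ)
    (hmono : ∀ θ ∈ Ioo (0 : ℝ) (2 * π), 0 < Γ' θ)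
    (hcurv : (∀ θ ∈ Ioo (0 : ℝ) (2 * π), 0 ≤ Γ'' θ) ∨
      (∀ θ ∈ Ioo (0 : ℝ) (2 * π), Γ'' θ ≤ 0))
    (hlim0 : Tendsto Γ (𝓝[>] (0 : ℝ)) (𝓝 L₀))
    (hlim2π : Tendsto Γ (𝓝[<] (2 * π)) (𝓝 L₂π))
    (Θ : ℝ → ℕ → ℝ)
    (hΘ : IsSolFull N Γ (Ici 0) Θ)
    (hΘC : ∀ t ∈ Ici (0 : ℝ), inCone N (Θ t)) :
    ∀ t ∈ Ici (0 : ℝ), ∀ k ∈ Finset.Icc 1 (N - 1), Θ t k = 2 * π * k / N := by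
  have hΓ : StrictMonoOn Γ (Ioo 0 (2 * π)) := by
    refine strictMonoOn_of_deriv_pos (convex_Ioo _ _)
      (fun θ hθ => (hd1 θ hθ).continuousAt.continuousWithinAt) fun θ hθ => ?_
    rw [interior_Ioo] at hθ
    rw [(hd1 θ hθ).deriv]
    exact hmono θ hθ
  set X : ℝ → ℕ → ℝ := fun t => withReference (Θ t) with hX
  have hord : ∀ t, 0 ≤ t → IsOrdered N (X t) := fun t ht => (hΘC t ht).isOrdered
  have hXd : ∀ k < N, ∀ t, 0 ≤ t →
      HasDerivAt (fun s => X s k) (coupling N Γ (X t) k - coupling N Γ (X t) 0) t := by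
    intro k hk t ht
    rcases Nat.eq_zero_or_pos k with rfl | hk0
    · simpa [hX, withReference] using hasDerivAt_const t (0 : ℝ)
    · have hmem : k ∈ Finset.Icc 1 (N - 1) := Finset.mem_Icc.2 ⟨hk0, by omega⟩
      have h := hΘ k hmem t ht
      rw [fullRHS_eq_coupling_sub Γ _ hmem] at h
      simpa [hX, withReference, hk0.ne'] using h
  have main : ∀ t, 0 ≤ t → ∀ k < N, ∀ l < N,
      (X t k - splay N k) - (X t l - splay N l) ≤ 0 := by
    intro a ha k₀ hk₀ l₀ hl₀
    by_contra! hpos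
    obtain ⟨c, hc, hcΓ⟩ := (isOrdered_splay N).exists_pos_le_coupling_term_sub hper hΓ hpos
    set A := (X a k₀ - splay N k₀) - (X a l₀ - splay N l₀) with hA
    have hT : a ≤ a + 8 * π / c := by
      have : 0 ≤ 8 * π / c := by positivity
      linarith
    obtain ⟨⟨k, l⟩, hkl, hbig⟩ := exists_add_mul_le_of_deriv_max_ge
      (Finset.range N ×ˢ Finset.range N)
      (fun p s => (X s p.1 - splay N p.1) - (X s p.2 - splay N p.2))
      (fun p s => (coupling N Γ (X s) p.1 - coupling N Γ (X s) 0) -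
        (coupling N Γ (X s) p.2 - coupling N Γ (X s) 0)) (a := a) (A := A) hc
      (by
        rintro ⟨k, l⟩ hkl t ht
        simp only [Finset.mem_product, Finset.mem_range] at hkl
        exact ((hXd k hkl.1 t (ha.trans ht)).sub_const _).sub
          ((hXd l hkl.2 t (ha.trans ht)).sub_const _))
      (by
        rintro ⟨k, l⟩ hkl t ht hmax hle
        simp only [Finset.mem_product, Finset.mem_range] at hkl hmax hle ⊢
        obtain ⟨hk, hl⟩ := hkl
        have hne : l ≠ k := by
          rintro rfl
          linarith
        have ho := hord t (ha.trans ht)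
        have hso := isOrdered_splay N
        have h1 : c ≤ coupling N Γ (X t) k - coupling N Γ (splay N) k := by
          rw [coupling, coupling, ← Finset.sum_sub_distrib]
          refine (hcΓ k hk l hl hne (X t) ho (by linarith)).trans
            (Finset.single_le_sum (f := fun j => Γ (X t k - X t j) - Γ (splay N k - splay N j))
              (fun j hj => ?_) (Finset.mem_erase.2 ⟨hne, Finset.mem_range.2 hl⟩))
          obtain ⟨hjk, hj⟩ := Finset.mem_erase.1 hj
          rw [Finset.mem_range] at hj
          have := hmax (j, l) ⟨hj, hl⟩
          exact sub_nonneg.2 (ho.coupling_term_mono hso hper hΓ hk hj hjk (by linarith))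
        have h2 : coupling N Γ (X t) l ≤ coupling N Γ (splay N) l := by
          refine Finset.sum_le_sum fun j hj => ?_
          obtain ⟨hjl, hj⟩ := Finset.mem_erase.1 hj
          rw [Finset.mem_range] at hj
          have := hmax (k, j) ⟨hk, hj⟩
          exact hso.coupling_term_mono ho hper hΓ hl hj hjl (by linarith)
        rw [coupling_splay hper hk] at h1
        rw [coupling_splay hper hl] at h2
        linarith)
      ⟨(k₀, l₀), by simp [hk₀, hl₀], le_rfl⟩ hT
    simp only [Finset.mem_product, Finset.mem_range] at hkl hbig
    have hlt : ∀ x, IsOrdered N x → ∀ i < N, ∀ j < N, x i - x j < 2 * π := by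
      intro x hx i hi j hj
      rcases lt_trichotomy j i with h | rfl | h
      · exact (hx _ _ h hi).2
      · simpa using pi_pos
      · linarith [(hx _ _ h hj).1, pi_pos]
    have b1 := hlt _ (hord _ (ha.trans hT)) k hkl.1 l hkl.2
    have b2 := hlt _ (isOrdered_splay N) l hkl.2 k hkl.1
    have e : c / 2 * (a + 8 * π / c - a) = 4 * π := by
      field_simp
      ring
    linarith
  intro t ht k hk
  have hk' := Finset.mem_Icc.1 hk
  have h1 := main t ht k (by omega) 0 (by omega)
  have h2 := main t ht 0 (by omega) k (by omega)
  simp only [hX, withReference, splay, show k ≠ 0 by omega, if_true, if_false,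
    Nat.cast_zero, mul_zero, zero_div] at h1 h2
  linarith
end
end
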